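/- Lower bound for quantum state splitting: Let ε > 0 and let Ψ_RAC be a pure state on R×A×C. Suppose given finite nonempty index types S_A, S_B, M, T_A, T_B with |C|·|S_A| = |M|·|T_A| and |S_B|·|M| = |C|·|T_B|; a unit vector θ on S_A×S_B; a unitary matrix U : Matrix (M×T_A) (C×S_A) ℂ; and a unitary matrix V : Matrix (C×T_B) (S_B×M) ℂ. Let Φ be the density matrix obtained from |Ψ⟩⟨Ψ| ⊗ |θ⟩⟨θ| by first applying U on the factors C×S_A (tensored with the identity on the remaining factors), producing factors M×T_A, and then applying V on the factors S_B×M (tensored with the identity on the remaining factors), producing factors C×T_B, with the resulting factors reordered as R×A×C×T_A×T_B. If the marginal Φ_RAC lies in B^ε(|Ψ⟩⟨Ψ|_RAC), then log|M| ≥ (1/2)·Imax^ε(R : C)_{Ψ_RC}. -/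

import Mathlib

open scoped Kronecker BigOperators
open Matrix
open scoped ComplexOrder Classical

noncomputable section

/-- A density matrix: positive semidefinite with unit trace. -/
def IsDensityMatrix {d : Type*} [Fintype d] (ρ : Matrix d d ℂ) : Prop :=
  ρ.PosSemidef ∧ ρ.trace = 1

/-- Loewner order on Hermitian matrices: `A ≤ B` iff `B - A` is positive semidefinite. -/
def LoewnerLE {d : Type*} [Fintype d] (A B : Matrix d d ℂ) : Prop := (B - A).PosSemidef

/-- Partial trace over the second tensor factor. -/
def ptrace2 {d₁ d₂ : Type*} [Fintype d₂] (M : Matrix (d₁ × d₂) (d₁ × d₂) ℂ) :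
    Matrix d₁ d₁ ℂ :=
  fun i i' => ∑ k, M (i, k) (i', k)

/-- Partial trace over the first tensor factor. -/
def ptrace1 {d₁ d₂ : Type*} [Fintype d₁] (M : Matrix (d₁ × d₂) (d₁ × d₂) ℂ) :
    Matrix d₂ d₂ ℂ :=
  fun j j' => ∑ k, M (k, j) (k, j')

/-- Functional calculus for Hermitian matrices: apply `f` to the eigenvalues. -/
def hermCFC {d : Type*} [Fintype d] [DecidableEq d] (f : ℝ → ℝ) (A : Matrix d d ℂ) :
    Matrix d d ℂ :=
  if hA : A.IsHermitian then
    (hA.eigenvectorUnitary : Matrix d d ℂ) *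
      Matrix.diagonal (fun i => (f (hA.eigenvalues i) : ℂ)) *
      (star (hA.eigenvectorUnitary : Matrix d d ℂ))
  else 0

/-- Matrix logarithm, base 2, applied to nonzero eigenvalues. -/
def matLog2 {d : Type*} [Fintype d] [DecidableEq d] (A : Matrix d d ℂ) : Matrix d d ℂ :=
  hermCFC (Real.logb 2) A

/-- Positive semidefinite square root (via functional calculus). -/
def matSqrt {d : Type*} [Fintype d] [DecidableEq d] (A : Matrix d d ℂ) : Matrix d d ℂ :=
  hermCFC Real.sqrt A

/-- Support containment: the kernel of `σ` is contained in the kernel of `ρ`. -/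
def SupportLE {d : Type*} [Fintype d] (ρ σ : Matrix d d ℂ) : Prop :=
  ∀ v : d → ℂ, σ.mulVec v = 0 → ρ.mulVec v = 0

/-- Relative entropy, base 2, as a real number (meaningful when supports are nested). -/
def relentR {d : Type*} [Fintype d] [DecidableEq d] (ρ σ : Matrix d d ℂ) : ℝ :=
  ((ρ * matLog2 ρ).trace - (ρ * matLog2 σ).trace).re

/-- Relative entropy `D(ρ‖σ)`, base 2, valued in the extended reals: `+∞` unless
the support of `ρ` is contained in the support of `σ`. -/
def relent {d : Type*} [Fintype d] [DecidableEq d] (ρ σ : Matrix d d ℂ) : EReal :=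
  if SupportLE ρ σ then ((relentR ρ σ : ℝ) : EReal) else ⊤

/-- Mutual information `I(A:B)_ρ = D(ρ_AB ‖ ρ_A ⊗ ρ_B)`. -/
def mutInfo {d₁ d₂ : Type*} [Fintype d₁] [Fintype d₂] [DecidableEq d₁] [DecidableEq d₂]
    (ρ : Matrix (d₁ × d₂) (d₁ × d₂) ℂ) : EReal :=
  relent ρ (ptrace2 ρ ⊗ₖ ptrace1 ρ)

/-- Fidelity `F(ρ,σ) = Tr √(√σ ρ √σ)`. -/
def fidelity {d : Type*} [Fintype d] [DecidableEq d] (ρ σ : Matrix d d ℂ) : ℝ :=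
  ((matSqrt (matSqrt σ * ρ * matSqrt σ)).trace).re

/-- Purified distance `P(ρ,σ) = √(1 - F(ρ,σ)²)`. -/
def pdist {d : Type*} [Fintype d] [DecidableEq d] (ρ σ : Matrix d d ℂ) : ℝ :=
  Real.sqrt (1 - (fidelity ρ σ) ^ 2)

/-- Max-relative entropy `Dmax(ρ‖σ) = inf {λ : ρ ≤ 2^λ σ}`, valued in the extended reals. -/
def dmax {d : Type*} [Fintype d] (ρ σ : Matrix d d ℂ) : EReal :=
  sInf {x : EReal | ∃ l : ℝ, x = (l : EReal) ∧ LoewnerLE ρ (((2 : ℝ) ^ l) • σ)}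

/-- Max-information `Imax(A:B)_ρ`. -/
def imax {d₁ d₂ : Type*} [Fintype d₁] [Fintype d₂]
    (ρ : Matrix (d₁ × d₂) (d₁ × d₂) ℂ) : EReal :=
  ⨅ σ : {σ : Matrix d₂ d₂ ℂ // IsDensityMatrix σ}, dmax ρ (ptrace2 ρ ⊗ₖ σ.1)

/-- Smooth max-information `Imax^ε(A:B)_ρ`. -/
def imaxEps {d₁ d₂ : Type*} [Fintype d₁] [Fintype d₂] [DecidableEq d₁] [DecidableEq d₂]
    (ε : ℝ) (ρ : Matrix (d₁ × d₂) (d₁ × d₂) ℂ) : EReal :=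
  ⨅ ρ' : {ρ' : Matrix (d₁ × d₂) (d₁ × d₂) ℂ // IsDensityMatrix ρ' ∧ pdist ρ ρ' ≤ ε},
    imax ρ'.1

/-- The `j`-th term of the convex split: `ρ` on `P` and the `j`-th copy of `Q`, and
`σ` on every other copy of `Q`. -/
def blockState {P Q : Type*} [Fintype Q] [DecidableEq Q]
    (ρ : Matrix (P × Q) (P × Q) ℂ) (σ : Matrix Q Q ℂ) (n : ℕ) (j : Fin n) :
    Matrix (P × (Fin n → Q)) (P × (Fin n → Q)) ℂ :=
  fun x y => ρ (x.1, x.2 j) (y.1, y.2 j) * ∏ i ∈ Finset.univ.erase j, σ (x.2 i) (y.2 i)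

/-- The convex-split state `τ = (1/n) Σ_j ρ_{PQ_j} ⊗ σ_{Q_1} ⊗ ⋯ ⊗ σ_{Q_n}` (omitting `j`). -/
def convexSplit {P Q : Type*} [Fintype Q] [DecidableEq Q]
    (ρ : Matrix (P × Q) (P × Q) ℂ) (σ : Matrix Q Q ℂ) (n : ℕ) :
    Matrix (P × (Fin n → Q)) (P × (Fin n → Q)) ℂ :=
  ((n : ℂ)⁻¹) • ∑ j : Fin n, blockState ρ σ n j

/-- A finite nonempty index type. -/
structure FinIdx where
  carrier : Type
  [fin : Fintype carrier]
  [deq : DecidableEq carrier]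
  [ne : Nonempty carrier]

attribute [instance] FinIdx.fin FinIdx.deq FinIdx.ne

section Protocol

variable {R A C SA SB M TA TB : Type}
  [Fintype R] [Fintype A] [Fintype C] [Fintype SA] [Fintype SB]
  [Fintype M] [Fintype TA] [Fintype TB]

/-- The global pure state after Alice applies the unitary `U` on her registers `C × SA`
(producing `M × TA`), starting from `Ψ_RAC ⊗ θ_{SA,SB}`. -/
def stepU (ψ : (R × C) × A → ℂ) (θ : SA × SB → ℂ)
    (U : Matrix (M × TA) (C × SA) ℂ) :
    (R × A × SB) × (M × TA) → ℂ :=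
  fun x => ∑ cs : C × SA,
    U x.2 cs * ψ ((x.1.1, cs.1), x.1.2.1) * θ (cs.2, x.1.2.2)

/-- The global pure state after Bob additionally applies the unitary `V` on his
registers `SB × M` (producing `C × TB`). -/
def stepV (ψ : (R × C) × A → ℂ) (θ : SA × SB → ℂ)
    (U : Matrix (M × TA) (C × SA) ℂ) (V : Matrix (C × TB) (SB × M) ℂ) :
    (R × A × TA) × (C × TB) → ℂ :=
  fun y => ∑ x : SB × M,
    V y.2 x * stepU ψ θ U ((y.1.1, y.1.2.1, x.1), (x.2, y.1.2.2))

/-- The final global pure state, with factors reordered as `((R × C) × A) × (TA × TB)`. -/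
def finalVec (ψ : (R × C) × A → ℂ) (θ : SA × SB → ℂ)
    (U : Matrix (M × TA) (C × SA) ℂ) (V : Matrix (C × TB) (SB × M) ℂ) :
    ((R × C) × A) × (TA × TB) → ℂ :=
  fun z => stepV ψ θ U V ((z.1.1.1, z.1.2, z.2.1), (z.1.1.2, z.2.2))

end Protocol

section Fidelity

variable {d n : Type*} [Fintype d] [Fintype n] [DecidableEq d]

theorem hermCFC_isHermitian (f : ℝ → ℝ) (A : Matrix d d ℂ) : (hermCFC f A).IsHermitian := by
  unfold hermCFC
  split_ifs with hA
  · simp only [Matrix.IsHermitian, conjTranspose_mul, star_eq_conjTranspose,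
      conjTranspose_conjTranspose, diagonal_conjTranspose, mul_assoc]
    congr 3
    ext i
    simp
  · exact isHermitian_zero

theorem hermCFC_mul (f g : ℝ → ℝ) (A : Matrix d d ℂ) :
    hermCFC f A * hermCFC g A = hermCFC (fun x => f x * g x) A := by
  unfold hermCFC
  split_ifs with hA
  · have h : star (hA.eigenvectorUnitary : Matrix d d ℂ) * (hA.eigenvectorUnitary : Matrix d d ℂ)
        = 1 := Unitary.coe_star_mul_self _
    simp only [mul_assoc]
    rw [← mul_assoc (star (hA.eigenvectorUnitary : Matrix d d ℂ)), h, one_mul,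
      ← mul_assoc (diagonal _), diagonal_mul_diagonal]
    simp
  · simp

theorem hermCFC_congr {f g : ℝ → ℝ} {A : Matrix d d ℂ}
    (h : ∀ hA : A.IsHermitian, ∀ i, f (hA.eigenvalues i) = g (hA.eigenvalues i)) :
    hermCFC f A = hermCFC g A := by
  unfold hermCFC
  split_ifs with hA
  · simp only [h hA]
  · rfl

theorem hermCFC_id {A : Matrix d d ℂ} (hA : A.IsHermitian) : hermCFC (fun x => x) A = A := by
  conv_rhs => rw [hA.spectral_theorem]
  simp only [hermCFC, dif_pos hA, Unitary.conjStarAlgAut_apply]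
  rfl

theorem posSemidef_matSqrt (A : Matrix d d ℂ) : (matSqrt A).PosSemidef := by
  have h : matSqrt A = hermCFC (fun x => √√x) A * (hermCFC (fun x => √√x) A)ᴴ := by
    rw [(hermCFC_isHermitian _ A).eq, hermCFC_mul]
    simp [matSqrt]
  rw [h]
  exact posSemidef_self_mul_conjTranspose _

theorem matSqrt_mul_self {A : Matrix d d ℂ} (hA : A.PosSemidef) : matSqrt A * matSqrt A = A := by
  rw [matSqrt, hermCFC_mul]
  exact (hermCFC_congr fun _ i => Real.mul_self_sqrt (hA.eigenvalues_nonneg i)).trans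
    (hermCFC_id hA.1)

open scoped MatrixOrder Matrix.Norms.L2Operator in
theorem matSqrt_eq_of_mul_self {A B : Matrix d d ℂ} (hB : B.PosSemidef) (h : B * B = A) :
    matSqrt A = B := by
  have hA : A.PosSemidef := by
    rw [← h]
    simpa [hB.1.eq] using posSemidef_self_mul_conjTranspose B
  exact (CFC.mul_self_eq_mul_self_iff _ _ (posSemidef_matSqrt A).nonneg hB.nonneg).1
    ((matSqrt_mul_self hA).trans h.symm)

/-- A Douglas-type factorization: if `N Nᴴ ≤ S²` then `N` factors through `S` by a contraction. -/
theorem exists_contraction_factor {S : Matrix d d ℂ} (hS : S.IsHermitian) {N : Matrix d n ℂ}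
    (h : (S * S - N * Nᴴ).PosSemidef) :
    ∃ D : Matrix d n ℂ, S * D = N ∧ (1 - D * Dᴴ).PosSemidef := by
  obtain ⟨P, hP, hSP, hSPS⟩ : ∃ P : Matrix d d ℂ, Pᴴ = P ∧ S * P = P * S ∧ S * P * S = S := by
    refine ⟨hermCFC (fun x => x⁻¹) S, hermCFC_isHermitian _ _, ?_, ?_⟩
    · nth_rw 1 [← hermCFC_id hS]
      nth_rw 4 [← hermCFC_id hS]
      simp only [hermCFC_mul, mul_comm]
    · nth_rw 1 [← hermCFC_id hS]
      nth_rw 3 [← hermCFC_id hS]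
      rw [hermCFC_mul, hermCFC_mul]
      refine (hermCFC_congr fun _ i => ?_).trans (hermCFC_id hS)
      exact mul_inv_mul_cancel _
  have hC : (1 - S * P)ᴴ = 1 - S * P := by
    simp [hP, hS.eq, hSP]
  have hker : (1 - S * P) * N = 0 := by
    rw [← trace_mul_conjTranspose_self_eq_zero_iff]
    have h1 := (h.mul_mul_conjTranspose_same (1 - S * P)).trace_nonneg
    have h2 : (1 - S * P) * (S * S - N * Nᴴ) * (1 - S * P)ᴴ
        = - ((1 - S * P) * N * ((1 - S * P) * N)ᴴ) := by
      have : (1 - S * P) * S = 0 := by rw [sub_mul, one_mul, hSPS, sub_self]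
      rw [mul_sub, ← Matrix.mul_assoc, this, zero_mul, zero_sub, conjTranspose_mul, neg_mul]
      simp only [Matrix.mul_assoc]
    rw [h2, trace_neg] at h1
    exact le_antisymm (neg_nonneg.1 h1) (posSemidef_self_mul_conjTranspose _).trace_nonneg
  refine ⟨P * N, ?_, ?_⟩
  · rw [Matrix.sub_mul, Matrix.one_mul, sub_eq_zero] at hker
    rw [← Matrix.mul_assoc, ← hker]
  · have h1 : 1 - P * N * (P * N)ᴴ
        = (1 - S * P) * (1 - S * P)ᴴ + P * (S * S - N * Nᴴ) * Pᴴ := by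
      have e2 : S * P * (S * P) = S * P := by rw [← Matrix.mul_assoc, hSPS]
      have e1 : P * (S * S) * P = S * P := by
        rw [← Matrix.mul_assoc, ← hSP, Matrix.mul_assoc (S * P), e2]
      rw [hC, conjTranspose_mul, hP, mul_sub P, sub_mul _ _ P, e1, sub_mul, mul_sub,
        mul_sub (S * P), e2]
      simp only [Matrix.mul_assoc, one_mul, mul_one]
      abel
    rw [h1]
    exact (posSemidef_self_mul_conjTranspose _).add (h.mul_mul_conjTranspose_same P)

/-- Cauchy–Schwarz for the form `tr (T D Qᴴ)` on contractions. -/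
theorem re_trace_mul_contractions_le {T : Matrix d d ℂ} (hT : T.PosSemidef) {D Q : Matrix d n ℂ}
    (hD : (1 - D * Dᴴ).PosSemidef) (hQ : (1 - Q * Qᴴ).PosSemidef) :
    (T * D * Qᴴ).trace.re ≤ T.trace.re := by
  have key : ∀ {X : Matrix d d ℂ}, X.PosSemidef → 0 ≤ (T * X).trace.re := by
    intro X hX
    have h1 := (hX.mul_mul_conjTranspose_same (matSqrt T)).trace_nonneg
    rw [(posSemidef_matSqrt T).1.eq, trace_mul_cycle, matSqrt_mul_self hT] at h1
    exact (Complex.le_def.1 h1).1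
  have h1 := key hD
  have h2 := key hQ
  have h3 := key (posSemidef_self_mul_conjTranspose (D - Q))
  have h4 : (T * Q * Dᴴ).trace.re = (T * D * Qᴴ).trace.re := by
    have : (T * Q * Dᴴ).trace = star (T * D * Qᴴ).trace := by
      rw [← trace_conjTranspose]
      simp only [conjTranspose_mul, conjTranspose_conjTranspose, hT.1.eq]
      rw [← Matrix.mul_assoc, trace_mul_cycle, trace_mul_cycle]
    rw [this]
    simp
  simp only [conjTranspose_sub, Matrix.mul_sub, Matrix.sub_mul, mul_one, ← Matrix.mul_assoc,
    trace_sub, Complex.sub_re] at h1 h2 h3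
  linarith

theorem re_trace_le_fidelity {σ : Matrix d d ℂ} (hσ : σ.PosSemidef) {K N : Matrix d n ℂ}
    (h : (σ - N * Nᴴ).PosSemidef) : (Kᴴ * N).trace.re ≤ fidelity (K * Kᴴ) σ := by
  set S := matSqrt σ with hS
  have hSh : Sᴴ = S := (posSemidef_matSqrt σ).1
  have hρ : S * (K * Kᴴ) * S = S * K * (S * K)ᴴ := by
    rw [conjTranspose_mul, hSh]
    simp only [Matrix.mul_assoc]
  set T := matSqrt (S * (K * Kᴴ) * S) with hTdef
  have hT : T.PosSemidef := posSemidef_matSqrt _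
  have hTT : T * T = S * K * (S * K)ᴴ := by
    rw [hTdef, hρ]
    exact matSqrt_mul_self (posSemidef_self_mul_conjTranspose _)
  obtain ⟨D, hD, hD1⟩ := exists_contraction_factor (posSemidef_matSqrt σ).1 (N := N)
    (by rwa [matSqrt_mul_self hσ])
  obtain ⟨Q, hQ, hQ1⟩ := exists_contraction_factor hT.1 (N := S * K)
    (by rw [hTT, sub_self]; exact .zero)
  have e : (Kᴴ * N).trace = (T * D * Qᴴ).trace := by
    rw [← hD, ← Matrix.mul_assoc, ← hS]
    have : Kᴴ * S = Qᴴ * T := by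
      have := congrArg conjTranspose hQ
      rw [conjTranspose_mul, conjTranspose_mul, hSh, hT.1.eq] at this
      exact this.symm
    rw [this, Matrix.mul_assoc, trace_mul_comm]
  rw [e]
  exact re_trace_mul_contractions_le hT hD1 hQ1

theorem fidelity_pure {σ : Matrix d d ℂ} (hσ : σ.PosSemidef) (ψ : d → ℂ) :
    fidelity (vecMulVec ψ (star ψ)) σ = √(star ψ ⬝ᵥ σ *ᵥ ψ).re := by
  set S := matSqrt σ with hS
  have hSh : Sᴴ = S := (posSemidef_matSqrt σ).1
  set w := S *ᵥ ψ with hw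
  have h1 : S * vecMulVec ψ (star ψ) * S = vecMulVec w (star w) := by
    rw [mul_vecMulVec, vecMulVec_mul, hw, star_mulVec, hSh]
  have h2 : star w ⬝ᵥ w = star ψ ⬝ᵥ σ *ᵥ ψ := by
    rw [hw, star_mulVec, hSh, ← dotProduct_mulVec, mulVec_mulVec, matSqrt_mul_self hσ]
  set r : ℝ := (star w ⬝ᵥ w).re with hr
  have h0 : 0 ≤ star w ⬝ᵥ w := dotProduct_star_self_nonneg w
  have hr0 : 0 ≤ r := (Complex.le_def.1 h0).1
  have hrc : star w ⬝ᵥ w = (r : ℂ) :=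
    Complex.ext rfl (by simpa using (Complex.le_def.1 h0).2.symm)
  have h3 : matSqrt (vecMulVec w (star w)) = (√r)⁻¹ • vecMulVec w (star w) := by
    refine matSqrt_eq_of_mul_self ?_ ?_
    · exact (posSemidef_vecMulVec_self_star w).smul (inv_nonneg.2 (Real.sqrt_nonneg r))
    · rw [smul_mul_smul_comm, vecMulVec_mul_vecMulVec, hrc]
      rcases eq_or_ne r 0 with h | h
      · have : w = 0 := dotProduct_star_self_eq_zero.1 (by rw [hrc, h]; simp)
        simp [this]
      · have : (√r)⁻¹ * (√r)⁻¹ * r = 1 := by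
          rw [← mul_inv, Real.mul_self_sqrt hr0, inv_mul_cancel₀ h]
        rw [vecMulVec_smul, Complex.coe_smul, smul_smul, this, one_smul]
  rw [fidelity, h1, h3, ← h2, trace_smul, trace_vecMulVec, dotProduct_comm, hrc]
  rw [Complex.smul_re, Complex.ofReal_re, smul_eq_mul, inv_mul_eq_div, Real.div_sqrt]

end Fidelity

section Gram

variable {d n : Type*} [Fintype d] [Fintype n]

theorem norm_sum_mul_sq_le {ι : Type*} [Fintype ι] (f g : ι → ℂ) :
    ‖∑ i, f i * g i‖ ^ 2 ≤ (∑ i, ‖f i‖ ^ 2) * ∑ i, ‖g i‖ ^ 2 := by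
  refine le_trans ?_ (Finset.sum_mul_sq_le_sq_mul_sq Finset.univ (fun i => ‖f i‖) fun i => ‖g i‖)
  gcongr
  exact (norm_sum_le _ _).trans_eq (by simp)

theorem star_dotProduct_self_eq (w : n → ℂ) : star w ⬝ᵥ w = ((∑ k, ‖w k‖ ^ 2 : ℝ) : ℂ) := by
  simp only [dotProduct, Pi.star_apply, Complex.ofReal_sum, Complex.ofReal_pow]
  exact Finset.sum_congr rfl fun k _ => Complex.conj_mul' (w k)

theorem star_dotProduct_mul_conjTranspose_mulVec (Z : Matrix d n ℂ) (v : d → ℂ) :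
    star v ⬝ᵥ (Z * Zᴴ) *ᵥ v = ((∑ k, ‖(Zᴴ *ᵥ v) k‖ ^ 2 : ℝ) : ℂ) := by
  rw [← star_dotProduct_self_eq, star_mulVec, conjTranspose_conjTranspose, ← dotProduct_mulVec,
    mulVec_mulVec]

theorem posSemidef_smul_gram_sub_gram {m : Type*} [Fintype m] {c : ℝ} {Y : Matrix d m ℂ}
    {Z : Matrix d n ℂ}
    (h : ∀ v, ∑ k, ‖(Zᴴ *ᵥ v) k‖ ^ 2 ≤ c * ∑ k, ‖(Yᴴ *ᵥ v) k‖ ^ 2) :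
    (c • (Y * Yᴴ) - Z * Zᴴ).PosSemidef := by
  refine .of_dotProduct_mulVec_nonneg ?_ fun v => ?_
  · refine IsHermitian.sub ?_ (isHermitian_mul_conjTranspose_self Z)
    rw [Matrix.IsHermitian, conjTranspose_smul, (isHermitian_mul_conjTranspose_self Y).eq,
      star_trivial]
  · rw [sub_mulVec, dotProduct_sub, smul_mulVec, dotProduct_smul,
      star_dotProduct_mul_conjTranspose_mulVec, star_dotProduct_mul_conjTranspose_mulVec,
      Complex.real_smul, ← Complex.ofReal_mul, ← Complex.ofReal_sub]
    exact Complex.zero_le_real.2 (sub_nonneg.2 (h v))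

end Gram

section PartialTrace

variable {X A T : Type*} [Fintype A] [Fintype T]

theorem ptrace2_vecMulVec (φ : X × T → ℂ) :
    ptrace2 (vecMulVec φ (star φ)) =
      (of fun x t => φ (x, t) : Matrix X T ℂ) * (of fun x t => φ (x, t))ᴴ := by
  ext i j
  simp [ptrace2, mul_apply, vecMulVec_apply]

theorem ptrace2_ptrace2_vecMulVec (φ : (X × A) × T → ℂ) :
    ptrace2 (ptrace2 (vecMulVec φ (star φ))) =
      (of fun x p => φ ((x, p.1), p.2) : Matrix X (A × T) ℂ) *
        (of fun x p => φ ((x, p.1), p.2) : Matrix X (A × T) ℂ)ᴴ := by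
  ext i j
  simp only [ptrace2, vecMulVec_apply, Pi.star_apply, mul_apply, conjTranspose_apply, of_apply,
    Fintype.sum_prod_type]

theorem trace_ptrace2 [Fintype X] (ρ : Matrix (X × A) (X × A) ℂ) :
    (ptrace2 ρ).trace = ρ.trace := by
  simp [ptrace2, trace, Fintype.sum_prod_type]

variable [Fintype X] [DecidableEq X] [DecidableEq A]

/-- Monotonicity of the fidelity with a pure state under the partial trace. -/
theorem fidelity_le_fidelity_ptrace2 (ψ : X × A → ℂ) (φ : (X × A) × T → ℂ) :
    fidelity (vecMulVec ψ (star ψ)) (ptrace2 (vecMulVec φ (star φ))) ≤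
      fidelity (ptrace2 (vecMulVec ψ (star ψ)))
        (ptrace2 (ptrace2 (vecMulVec φ (star φ)))) := by
  set G : Matrix (X × A) T ℂ := of fun x t => φ (x, t) with hG
  set L : Matrix X (A × T) ℂ := of fun x p => φ ((x, p.1), p.2) with hL
  set K : Matrix X A ℂ := of fun x a => ψ (x, a) with hK
  set c : T → ℂ := Gᴴ *ᵥ ψ with hc
  set s : ℝ := √(∑ t, ‖c t‖ ^ 2) with hs
  have hs2 : s ^ 2 = ∑ t, ‖c t‖ ^ 2 := Real.sq_sqrt (by positivity)
  have hs0 : s⁻¹ * s ^ 2 = s := by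
    rcases eq_or_ne s 0 with h | h
    · simp [h]
    · field_simp
  set e : T → ℂ := fun t => (s⁻¹ : ℝ) * c t with he
  have he1 : ∑ t, ‖e t‖ ^ 2 ≤ 1 := by
    simp only [he, norm_mul, mul_pow, ← Finset.mul_sum, ← hs2, Complex.norm_real, norm_inv,
      Real.norm_eq_abs, inv_pow, sq_abs]
    exact inv_mul_le_one
  set N : Matrix X A ℂ := of fun x a => ∑ t, e t * L x (a, t) with hN
  rw [ptrace2_ptrace2_vecMulVec, ptrace2_vecMulVec φ, ptrace2_vecMulVec ψ,
    fidelity_pure (posSemidef_self_mul_conjTranspose _), ← hG, ← hL, ← hK,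
    star_dotProduct_mul_conjTranspose_mulVec, Complex.ofReal_re, ← hc, ← hs]
  have htr : (Kᴴ * N).trace = (s : ℂ) := by
    have h1 : (Kᴴ * N).trace = ∑ t, e t * star (c t) := by
      simp only [trace, diag_apply, mul_apply, conjTranspose_apply, hN, hK, hL, of_apply, hc, hG,
        mulVec, dotProduct, star_sum, star_mul', star_star, Finset.mul_sum,
        Fintype.sum_prod_type]
      rw [Finset.sum_comm]
      simp_rw [Finset.sum_comm (s := (Finset.univ : Finset A)) (t := (Finset.univ : Finset T))]
      rw [Finset.sum_comm]
      refine Finset.sum_congr rfl fun t _ => Finset.sum_congr rfl fun x _ =>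
        Finset.sum_congr rfl fun a _ => by ring
    have h2 : ∀ t, e t * star (c t) = ((s⁻¹ * ‖c t‖ ^ 2 : ℝ) : ℂ) := by
      intro t
      simp only [he, mul_assoc]
      rw [Complex.star_def, Complex.mul_conj']
      push_cast
      rfl
    rw [h1, Finset.sum_congr rfl fun t _ => h2 t, ← Complex.ofReal_sum, ← Finset.mul_sum, ← hs2,
      hs0]
  have hle : (L * Lᴴ - N * Nᴴ).PosSemidef := by
    rw [← one_smul ℝ (L * Lᴴ)]
    refine posSemidef_smul_gram_sub_gram fun v => ?_
    have h1 : ∀ a, (Nᴴ *ᵥ v) a = ∑ t, star (e t) * (Lᴴ *ᵥ v) (a, t) := by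
      intro a
      simp only [mulVec, dotProduct, conjTranspose_apply, hN, of_apply, star_sum, star_mul',
        Finset.sum_mul, Finset.mul_sum, mul_assoc]
      exact Finset.sum_comm
    rw [one_mul, Fintype.sum_prod_type]
    refine Finset.sum_le_sum fun a _ => ?_
    rw [h1]
    refine (norm_sum_mul_sq_le _ _).trans (mul_le_of_le_one_left (by positivity) ?_)
    simpa using he1
  have := re_trace_le_fidelity (posSemidef_self_mul_conjTranspose L) (K := K) hle
  rwa [htr, Complex.ofReal_re] at this

theorem pdist_ptrace2_le (ψ : X × A → ℂ) (φ : (X × A) × T → ℂ) :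
    pdist (ptrace2 (vecMulVec ψ (star ψ))) (ptrace2 (ptrace2 (vecMulVec φ (star φ)))) ≤
      pdist (vecMulVec ψ (star ψ)) (ptrace2 (vecMulVec φ (star φ))) := by
  have h0 : 0 ≤ fidelity (vecMulVec ψ (star ψ)) (ptrace2 (vecMulVec φ (star φ))) := by
    rw [ptrace2_vecMulVec, fidelity_pure (posSemidef_self_mul_conjTranspose _)]
    exact Real.sqrt_nonneg _
  unfold pdist
  gcongr
  exact fidelity_le_fidelity_ptrace2 ψ φ

end PartialTrace

section Isometry

variable {I J : Type*} [Fintype I] [Fintype J] [DecidableEq J]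

theorem sum_mulVec_mul_star_of_isometry {U : Matrix I J ℂ} (hU : Uᴴ * U = 1) (f g : J → ℂ) :
    ∑ i, (∑ j, U i j * f j) * star (∑ j, U i j * g j) = ∑ j, f j * star (g j) := by
  have h : star (U *ᵥ g) ⬝ᵥ (U *ᵥ f) = star g ⬝ᵥ f := by
    rw [star_mulVec, ← dotProduct_mulVec, mulVec_mulVec, hU, one_mulVec]
  simpa only [dotProduct, mulVec, Pi.star_apply, mul_comm (star _)] using h

theorem sum_norm_sq_of_isometry {U : Matrix I J ℂ} (hU : Uᴴ * U = 1) (f : J → ℂ) :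
    ∑ i, ‖∑ j, U i j * f j‖ ^ 2 = ∑ j, ‖f j‖ ^ 2 := by
  have h := sum_mulVec_mul_star_of_isometry hU f f
  simp only [Complex.star_def, Complex.mul_conj'] at h
  exact_mod_cast h

end Isometry

section MaxInformation

variable {X Y : Type*} [Fintype X] [Fintype Y]

theorem imax_le_of_loewnerLE {ρ : Matrix (X × Y) (X × Y) ℂ} {σ : Matrix Y Y ℂ}
    (hσ : IsDensityMatrix σ) {l : ℝ} (h : LoewnerLE ρ ((2 : ℝ) ^ l • (ptrace2 ρ ⊗ₖ σ))) :
    imax ρ ≤ (l : EReal) := by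
  refine iInf_le_of_le ⟨σ, hσ⟩ (sInf_le ?_)
  exact ⟨l, rfl, h⟩

theorem imaxEps_le_imax [DecidableEq X] [DecidableEq Y] {ε : ℝ}
    {ρ ρ' : Matrix (X × Y) (X × Y) ℂ} (hρ' : IsDensityMatrix ρ') (h : pdist ρ ρ' ≤ ε) :
    imaxEps ε ρ ≤ imax ρ' :=
  iInf_le (fun τ : {τ : Matrix (X × Y) (X × Y) ℂ // IsDensityMatrix τ ∧ pdist ρ τ ≤ ε} =>
    imax τ.1) ⟨ρ', hρ', h⟩

end MaxInformation

section Converse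

variable {R A C SA SB M TA TB : Type}
  [Fintype A] [Fintype C] [Fintype SA] [Fintype SB] [Fintype M] [Fintype TA] [Fintype TB]

/-- Gram factor of the operator `V (θ_SB ⊗ 1_M) Vᴴ` reduced to Bob's output register. -/
def bobFactor (θ : SA × SB → ℂ) (V : Matrix (C × TB) (SB × M) ℂ) :
    Matrix C (SA × TB × M) ℂ :=
  of fun c p => ∑ s, V (c, p.2.1) (s, p.2.2) * θ (p.1, s)

theorem trace_bobFactor_gram [DecidableEq SB] [DecidableEq M] {θ : SA × SB → ℂ}
    (hθ : ∑ i, ‖θ i‖ ^ 2 = 1) {V : Matrix (C × TB) (SB × M) ℂ} (hV : Vᴴ * V = 1) :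
    (bobFactor θ V * (bobFactor θ V)ᴴ).trace = (Fintype.card M : ℂ) := by
  have h1 : ∀ (sA : SA) (m : M), ∑ x : C × TB, ‖bobFactor θ V x.1 (sA, x.2, m)‖ ^ 2
      = ∑ s, ‖θ (sA, s)‖ ^ 2 := by
    intro sA m
    have h := sum_norm_sq_of_isometry hV (fun x => if x.2 = m then θ (sA, x.1) else 0)
    simp only [Fintype.sum_prod_type, mul_ite, mul_zero, Finset.sum_ite_eq', Finset.mem_univ,
      if_true, apply_ite (fun z : ℂ => ‖z‖ ^ 2), norm_zero] at h
    simpa [bobFactor, Fintype.sum_prod_type] using h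
  have h2 : (bobFactor θ V * (bobFactor θ V)ᴴ).trace
      = ((∑ c, ∑ p, ‖bobFactor θ V c p‖ ^ 2 : ℝ) : ℂ) := by
    simp only [trace, diag_apply, mul_apply, conjTranspose_apply, Complex.star_def,
      Complex.mul_conj']
    push_cast
    rfl
  have h3 : ∑ c, ∑ p, ‖bobFactor θ V c p‖ ^ 2 = ∑ m : M, ∑ sA : SA, ∑ x : C × TB,
      ‖bobFactor θ V x.1 (sA, x.2, m)‖ ^ 2 := by
    simp only [Fintype.sum_prod_type]
    rw [Finset.sum_comm]
    conv_rhs => rw [Finset.sum_comm]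
    exact Finset.sum_congr rfl fun sA _ => Finset.sum_comm_cycle
  rw [h2, h3]
  simp only [h1, ← Fintype.sum_prod_type', Prod.mk.eta, hθ]
  simp

/-- The state on `R` is untouched by the protocol. -/
theorem ptrace2_output_eq [DecidableEq C] [DecidableEq SA] [DecidableEq SB] [DecidableEq M]
    {ψ : (R × C) × A → ℂ} {θ : SA × SB → ℂ} (hθ : ∑ i, ‖θ i‖ ^ 2 = 1)
    {U : Matrix (M × TA) (C × SA) ℂ} (hU : Uᴴ * U = 1)
    {V : Matrix (C × TB) (SB × M) ℂ} (hV : Vᴴ * V = 1) :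
    ptrace2 (ptrace2 (ptrace2 (vecMulVec (finalVec ψ θ U V) (star (finalVec ψ θ U V))))) =
      ptrace2 (ptrace2 (vecMulVec ψ (star ψ))) := by
  ext r r'
  have hV' : ∀ a ta, ∑ y, stepV ψ θ U V ((r, a, ta), y) * star (stepV ψ θ U V ((r', a, ta), y))
      = ∑ x : SB × M, stepU ψ θ U ((r, a, x.1), (x.2, ta)) *
        star (stepU ψ θ U ((r', a, x.1), (x.2, ta))) := by
    intro a ta
    simp only [stepV]
    exact sum_mulVec_mul_star_of_isometry hV
      (fun x => stepU ψ θ U ((r, a, x.1), (x.2, ta)))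
      (fun x => stepU ψ θ U ((r', a, x.1), (x.2, ta)))
  have hU' : ∀ a s, ∑ y, stepU ψ θ U ((r, a, s), y) * star (stepU ψ θ U ((r', a, s), y))
      = ∑ x : C × SA, ψ ((r, x.1), a) * θ (x.2, s) * star (ψ ((r', x.1), a) * θ (x.2, s)) := by
    intro a s
    simpa only [stepU, mul_assoc] using sum_mulVec_mul_star_of_isometry hU
      (fun x => ψ ((r, x.1), a) * θ (x.2, s)) (fun x => ψ ((r', x.1), a) * θ (x.2, s))
  have hθ' : ∑ s, ∑ sA, θ (sA, s) * star (θ (sA, s)) = 1 := by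
    rw [Finset.sum_comm]
    simp only [← Fintype.sum_prod_type', Prod.mk.eta, Complex.star_def, Complex.mul_conj']
    exact_mod_cast hθ
  calc ptrace2 (ptrace2 (ptrace2 (vecMulVec (finalVec ψ θ U V) (star (finalVec ψ θ U V))))) r r'
      = ∑ a, ∑ ta, ∑ y, stepV ψ θ U V ((r, a, ta), y) *
          star (stepV ψ θ U V ((r', a, ta), y)) := by
        simp only [ptrace2, vecMulVec_apply, finalVec, Pi.star_apply, Fintype.sum_prod_type]
        rw [Finset.sum_comm]
        exact Finset.sum_congr rfl fun a _ => Finset.sum_comm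
    _ = ∑ a, ∑ s, ∑ y, stepU ψ θ U ((r, a, s), y) * star (stepU ψ θ U ((r', a, s), y)) := by
        refine Finset.sum_congr rfl fun a _ => ?_
        simp only [hV', Fintype.sum_prod_type]
        exact Finset.sum_comm_cycle.symm
    _ = ∑ a, (∑ c, ψ ((r, c), a) * star (ψ ((r', c), a))) *
          ∑ s, ∑ sA, θ (sA, s) * star (θ (sA, s)) := by
        refine Finset.sum_congr rfl fun a _ => ?_
        rw [Finset.mul_sum]
        refine Finset.sum_congr rfl fun s _ => ?_
        rw [hU', Finset.sum_mul_sum, Fintype.sum_prod_type]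
        refine Finset.sum_congr rfl fun c _ => Finset.sum_congr rfl fun sA _ => ?_
        rw [star_mul']
        ring
    _ = ptrace2 (ptrace2 (vecMulVec ψ (star ψ))) r r' := by
        simp only [hθ', mul_one, ptrace2, vecMulVec_apply, Pi.star_apply]
        exact Finset.sum_comm

/-- The operator inequality `Φ_RC ≤ |M| · Ψ_R ⊗ Tr_TB (V (θ_SB ⊗ 1_M) Vᴴ)`. -/
theorem output_le_card_smul [Fintype R] [DecidableEq C] [DecidableEq SA]
    {ψ : (R × C) × A → ℂ} {θ : SA × SB → ℂ}
    {U : Matrix (M × TA) (C × SA) ℂ} (hU : Uᴴ * U = 1) {V : Matrix (C × TB) (SB × M) ℂ} :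
    LoewnerLE (ptrace2 (ptrace2 (vecMulVec (finalVec ψ θ U V) (star (finalVec ψ θ U V)))))
      ((Fintype.card M : ℝ) • (ptrace2 (ptrace2 (vecMulVec ψ (star ψ))) ⊗ₖ
        (bobFactor θ V * (bobFactor θ V)ᴴ))) := by
  set Y : Matrix (R × C) (A × (C × SA) × TB × M) ℂ := of fun x p =>
    ψ ((x.1, p.2.1.1), p.1) * bobFactor θ V x.2 (p.2.1.2, p.2.2) with hY
  have hYY : ptrace2 (ptrace2 (vecMulVec ψ (star ψ))) ⊗ₖ (bobFactor θ V * (bobFactor θ V)ᴴ)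
      = Y * Yᴴ := by
    ext ⟨r, c⟩ ⟨r', c'⟩
    have h1 : ptrace2 (ptrace2 (vecMulVec ψ (star ψ))) r r'
        = ∑ a, ∑ c, ψ ((r, c), a) * star (ψ ((r', c), a)) := by
      simp only [ptrace2, vecMulVec_apply, Pi.star_apply]
      exact Finset.sum_comm
    rw [kroneckerMap_apply, h1, Finset.sum_mul]
    conv_rhs => rw [mul_apply, Fintype.sum_prod_type]
    refine Finset.sum_congr rfl fun a _ => ?_
    rw [mul_apply, Finset.sum_mul_sum]
    simp only [Fintype.sum_prod_type, hY, of_apply, conjTranspose_apply, star_mul']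
    refine Finset.sum_congr rfl fun c₀ _ => Finset.sum_congr rfl fun sA _ =>
      Finset.sum_congr rfl fun tb _ => Finset.sum_congr rfl fun m _ => by ring
  rw [LoewnerLE, hYY, ptrace2_ptrace2_vecMulVec]
  refine posSemidef_smul_gram_sub_gram fun v => ?_
  set Z : Matrix (R × C) (A × TA × TB) ℂ := of fun x p => finalVec ψ θ U V ((x, p.1), p.2) with hZ
  set g := Yᴴ *ᵥ v with hg
  have hZY : ∀ x a ta tb, Z x (a, ta, tb) = ∑ m, ∑ q, U (m, ta) q * Y x (a, q, tb, m) := by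
    intro x a ta tb
    simp only [hZ, hY, of_apply, finalVec, stepV, stepU, bobFactor, Finset.mul_sum]
    rw [Fintype.sum_prod_type, Finset.sum_comm]
    refine Finset.sum_congr rfl fun m _ => ?_
    rw [Finset.sum_comm]
    refine Finset.sum_congr rfl fun q _ => Finset.sum_congr rfl fun s _ => by ring
  have hZv : ∀ a ta tb, (Zᴴ *ᵥ v) (a, ta, tb)
      = ∑ m, star (∑ q, U (m, ta) q * star (g (a, q, tb, m))) := by
    intro a ta tb
    simp only [hg, mulVec, dotProduct, conjTranspose_apply, hZY, star_sum, star_mul', star_star,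
      Finset.sum_mul, Finset.mul_sum]
    rw [Finset.sum_comm]
    refine Finset.sum_congr rfl fun m _ => ?_
    rw [Finset.sum_comm]
    refine Finset.sum_congr rfl fun q _ => Finset.sum_congr rfl fun s _ => by ring
  have hiso : ∀ a tb m, ∑ ta, ‖∑ q, U (m, ta) q * star (g (a, q, tb, m))‖ ^ 2
      ≤ ∑ q, ‖g (a, q, tb, m)‖ ^ 2 := by
    intro a tb m
    have h := sum_norm_sq_of_isometry hU fun q => star (g (a, q, tb, m))
    simp only [norm_star] at h
    rw [← h, Fintype.sum_prod_type]
    exact Finset.single_le_sum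
      (f := fun m' => ∑ ta, ‖∑ q, U (m', ta) q * star (g (a, q, tb, m))‖ ^ 2)
      (fun _ _ => by positivity) (Finset.mem_univ m)
  calc ∑ k, ‖(Zᴴ *ᵥ v) k‖ ^ 2
      ≤ ∑ k : A × TA × TB, Fintype.card M *
          ∑ m, ‖∑ q, U (m, k.2.1) q * star (g (k.1, q, k.2.2, m))‖ ^ 2 := by
        refine Finset.sum_le_sum fun k _ => ?_
        obtain ⟨a, ta, tb⟩ := k
        rw [hZv]
        have h := norm_sum_mul_sq_le (fun _ : M => (1 : ℂ))
          fun m => star (∑ q, U (m, ta) q * star (g (a, q, tb, m)))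
        simpa only [one_mul, norm_one, one_pow, norm_star, Finset.sum_const, Finset.card_univ,
          nsmul_eq_mul, mul_one] using h
    _ = Fintype.card M * ∑ a, ∑ tb, ∑ m, ∑ ta,
          ‖∑ q, U (m, ta) q * star (g (a, q, tb, m))‖ ^ 2 := by
        rw [← Finset.mul_sum]
        congr 1
        simp only [Fintype.sum_prod_type (α₁ := A), Fintype.sum_prod_type (α₁ := TA)]
        exact Finset.sum_congr rfl fun a _ => Finset.sum_comm_cycle.symm
    _ ≤ Fintype.card M * ∑ a, ∑ tb, ∑ m, ∑ q, ‖g (a, q, tb, m)‖ ^ 2 := by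
        gcongr with a _ tb _ m _
        exact hiso a tb m
    _ = Fintype.card M * ∑ k, ‖g k‖ ^ 2 := by
        rw [Fintype.sum_prod_type]
        congr 1
        refine Finset.sum_congr rfl fun a _ => ?_
        rw [Fintype.sum_prod_type, Finset.sum_comm_cycle]
        exact Finset.sum_congr rfl fun q _ =>
          (Fintype.sum_prod_type fun x : TB × M => ‖g (a, q, x)‖ ^ 2).symm

/-- The output state of the protocol has max-information at most `2 log |M|`. -/
theorem imax_output_le [DecidableEq C] [DecidableEq SA] [DecidableEq SB] [DecidableEq M]
    [Fintype R] [Nonempty M] {ψ : (R × C) × A → ℂ} {θ : SA × SB → ℂ}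
    (hθ : ∑ i, ‖θ i‖ ^ 2 = 1) {U : Matrix (M × TA) (C × SA) ℂ} (hU : Uᴴ * U = 1)
    {V : Matrix (C × TB) (SB × M) ℂ} (hV : Vᴴ * V = 1) :
    imax (ptrace2 (ptrace2 (vecMulVec (finalVec ψ θ U V) (star (finalVec ψ θ U V))))) ≤
      ((2 * Real.logb 2 (Fintype.card M) : ℝ) : EReal) := by
  have hM : (0 : ℝ) < Fintype.card M := by exact_mod_cast Fintype.card_pos
  refine imax_le_of_loewnerLE (σ := (Fintype.card M : ℝ)⁻¹ • (bobFactor θ V * (bobFactor θ V)ᴴ))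
    ⟨(posSemidef_self_mul_conjTranspose _).smul (inv_nonneg.2 hM.le), ?_⟩ ?_
  · rw [trace_smul, trace_bobFactor_gram hθ hV, Complex.real_smul, Complex.ofReal_inv,
      Complex.ofReal_natCast, inv_mul_cancel₀ (by exact_mod_cast hM.ne')]
  · have h2 : (2 : ℝ) ^ (2 * Real.logb 2 (Fintype.card M)) * (Fintype.card M : ℝ)⁻¹
        = Fintype.card M := by
      rw [mul_comm 2, Real.rpow_mul (by norm_num), Real.rpow_logb (by norm_num) (by norm_num) hM,
        Real.rpow_two]
      field_simp
    rw [ptrace2_output_eq hθ hU hV, kronecker_smul, smul_smul, h2]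
    exact output_le_card_smul hU

end Converse

/-- **Lower bound for quantum state splitting.** Any one-way entanglement-assisted
state-splitting protocol with error `ε` must communicate at least
`(1/2)·Imax^ε(R:C)_{Ψ_RC}` qubits. -/
theorem state_splitting_lower_bound
    {R A C SA SB M TA TB : Type}
    [Fintype R] [Fintype A] [Fintype C] [Fintype SA] [Fintype SB]
    [Fintype M] [Fintype TA] [Fintype TB]
    [DecidableEq R] [DecidableEq A] [DecidableEq C] [DecidableEq SA]
    [DecidableEq SB] [DecidableEq M] [DecidableEq TA] [DecidableEq TB]
    [Nonempty R] [Nonempty A] [Nonempty C] [Nonempty SA] [Nonempty SB]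
    [Nonempty M] [Nonempty TA] [Nonempty TB]
    (ε : ℝ) (hε : 0 < ε)
    (ψ : (R × C) × A → ℂ) (hψ : ∑ i, ‖ψ i‖ ^ 2 = 1)
    (hcard1 : Fintype.card C * Fintype.card SA = Fintype.card M * Fintype.card TA)
    (hcard2 : Fintype.card SB * Fintype.card M = Fintype.card C * Fintype.card TB)
    (θ : SA × SB → ℂ) (hθ : ∑ i, ‖θ i‖ ^ 2 = 1)
    (U : Matrix (M × TA) (C × SA) ℂ)
    (hU1 : U * Uᴴ = 1) (hU2 : Uᴴ * U = 1)
    (V : Matrix (C × TB) (SB × M) ℂ)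
    (hV1 : V * Vᴴ = 1) (hV2 : Vᴴ * V = 1)
    (hout : IsDensityMatrix
        (ptrace2 (Matrix.vecMulVec (finalVec ψ θ U V) (star (finalVec ψ θ U V)))) ∧
      pdist (Matrix.vecMulVec ψ (star ψ))
        (ptrace2 (Matrix.vecMulVec (finalVec ψ θ U V) (star (finalVec ψ θ U V)))) ≤ ε) :
    ((1 / 2 : ℝ) : EReal) * imaxEps ε (ptrace2 (Matrix.vecMulVec ψ (star ψ)))
      ≤ ((Real.logb 2 (Fintype.card M) : ℝ) : EReal) := by
  have hdens : IsDensityMatrix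
      (ptrace2 (ptrace2 (vecMulVec (finalVec ψ θ U V) (star (finalVec ψ θ U V))))) := by
    refine ⟨?_, by rw [trace_ptrace2, hout.1.2]⟩
    rw [ptrace2_ptrace2_vecMulVec]
    exact posSemidef_self_mul_conjTranspose _
  have hsmooth : imaxEps ε (ptrace2 (vecMulVec ψ (star ψ))) ≤
      ((2 * Real.logb 2 (Fintype.card M) : ℝ) : EReal) :=
    (imaxEps_le_imax hdens ((pdist_ptrace2_le ψ _).trans hout.2)).trans
      (imax_output_le hθ hU2 hV2)
  calc ((1 / 2 : ℝ) : EReal) * imaxEps ε (ptrace2 (vecMulVec ψ (star ψ)))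
      ≤ ((1 / 2 : ℝ) : EReal) * ((2 * Real.logb 2 (Fintype.card M) : ℝ) : EReal) :=
        mul_le_mul_of_nonneg_left hsmooth (by exact_mod_cast (by norm_num : (0 : ℝ) ≤ 1 / 2))
    _ = ((Real.logb 2 (Fintype.card M) : ℝ) : EReal) := by
        rw [← EReal.coe_mul]
        congr 1
        ring

end
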